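/- arXiv:2603.14924 — 2 statements merged into one kernel-verified Lean document; each statement's English description precedes it below -/
import Mathlib

section
/- Let Z ⊆ ℝⁿ be a closed set and let W ⊆ ℝⁿ \ Z be closed in ℝⁿ \ Z. Then for every positive integer q and every η > 0 there exist a constant C > 0, a number ρ ∈ (0, η), and a function ω : ℝⁿ \ Z → [0, 1] of class C^q such that: (i) |D^α ω(x)| ≤ C / d(x, Z)^{|α|} for every x ∈ ℝⁿ \ Z and every multi-index α with |α| ≤ q; (ii) ω ≡ 1 on G_ρ(W, Z); and (iii) the support of ω in ℝⁿ \ Z is contained in G_η(W, Z). -/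
open scoped BigOperators NNReal

open Classical in
/-- Distance to a set, with the convention `d(x, ∅) = 1`. -/
noncomputable def d1 {X : Type*} [PseudoMetricSpace X] (x : X) (S : Set X) : ℝ :=
  if S.Nonempty then Metric.infDist x S else 1

/-- First-order partial derivative in direction `i`. -/
noncomputable def pd {k : ℕ} {F : Type*} [NormedAddCommGroup F] [NormedSpace ℝ F]
    (i : Fin k) (f : (Fin k → ℝ) → F) : (Fin k → ℝ) → F :=
  fun x => fderiv ℝ f x (Pi.single i 1)

/-- Iterated partial derivative `D^α` for a multi-index `α`. -/
noncomputable def mD {k : ℕ} {F : Type*} [NormedAddCommGroup F] [NormedSpace ℝ F]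
    (α : Fin k → ℕ) (f : (Fin k → ℝ) → F) : (Fin k → ℝ) → F :=
  (List.finRange k).foldr (fun i g => (pd i)^[α i] g) f

/-- `|α| = α₁ + ⋯ + α_k`. -/
def deg {k : ℕ} (α : Fin k → ℕ) : ℕ := ∑ i, α i

/-- `α! = α₁! ⋯ α_k!`. -/
def mfact {k : ℕ} (α : Fin k → ℕ) : ℕ := ∏ i, Nat.factorial (α i)

/-- The neighborhood `G_η(W, Z) = {x ∈ ℝⁿ \ Z : d(x, W) < η·d(x, Z)}` of `W` in `ℝⁿ \ Z`. -/
def Gnbhd {n : ℕ} (η : ℝ) (W Z : Set (Fin n → ℝ)) : Set (Fin n → ℝ) :=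
  {x | x ∉ Z ∧ d1 x W < η * d1 x Z}


namespace CqUry

/-- Iterated directional derivatives are values of the iterated Fréchet derivative. -/
def Q {n : ℕ} (U : Set (Fin n → ℝ)) (ω : (Fin n → ℝ) → ℝ) (j : ℕ) (h : (Fin n → ℝ) → ℝ) : Prop :=
  ∃ v : Fin j → (Fin n → ℝ), (∀ i, ‖v i‖ ≤ 1) ∧ ∀ x ∈ U, h x = iteratedFDeriv ℝ j ω x v

lemma Q_step {n q : ℕ} {U : Set (Fin n → ℝ)} (hU : IsOpen U) {ω : (Fin n → ℝ) → ℝ}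
    (hω : ContDiffOn ℝ (q : ℕ∞) ω U) {j : ℕ} {h : (Fin n → ℝ) → ℝ} (hj : j + 1 ≤ q)
    (hQ : Q U ω j h) (i : Fin n) : Q U ω (j + 1) (pd i h) := by
  obtain ⟨v, hv, hx⟩ := hQ
  refine ⟨Fin.cons (Pi.single i 1) v, ?_, ?_⟩
  · intro l
    refine Fin.cases ?_ ?_ l
    · rw [Fin.cons_zero, pi_norm_le_iff_of_nonneg zero_le_one]
      intro k
      by_cases hk : k = i
      · subst hk; simp
      · simp [hk]
    · intro l; simpa using hv l
  · intro x hxU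
    have hev : h =ᶠ[nhds x] fun y => iteratedFDeriv ℝ j ω y v := by
      filter_upwards [hU.mem_nhds hxU] with y hy using hx y hy
    have hd : DifferentiableAt ℝ (iteratedFDeriv ℝ j ω) x := by
      apply ContDiffAt.differentiableAt_iteratedFDeriv (hω.contDiffAt (hU.mem_nhds hxU))
      exact_mod_cast hj
    have := hd.iteratedFDeriv_succ_apply_left' (m := Fin.cons (Pi.single i 1) v)
    rw [this]
    simp only [pd, hev.fderiv_eq, Fin.cons_zero, Fin.tail_cons]

lemma Q_iter {n q : ℕ} {U : Set (Fin n → ℝ)} (hU : IsOpen U) {ω : (Fin n → ℝ) → ℝ}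
    (hω : ContDiffOn ℝ (q : ℕ∞) ω U) {j : ℕ} {h : (Fin n → ℝ) → ℝ} (i : Fin n) (a : ℕ)
    (hj : j + a ≤ q) (hQ : Q U ω j h) : Q U ω (j + a) ((pd i)^[a] h) := by
  induction a with
  | zero => simpa using hQ
  | succ a ih =>
    rw [Function.iterate_succ_apply']
    exact Q_step hU hω (by omega) (ih (by omega)) i

lemma Q_list {n q : ℕ} {U : Set (Fin n → ℝ)} (hU : IsOpen U) {ω : (Fin n → ℝ) → ℝ}
    (hω : ContDiffOn ℝ (q : ℕ∞) ω U) (α : Fin n → ℕ) (L : List (Fin n))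
    (hj : (L.map α).sum ≤ q) :
    Q U ω (L.map α).sum (L.foldr (fun i g => (pd i)^[α i] g) ω) := by
  induction L with
  | nil => exact ⟨Fin.elim0, fun i => i.elim0, fun x _ => (iteratedFDeriv_zero_apply _).symm⟩
  | cons i L ih =>
    simp only [List.map_cons, List.sum_cons, List.foldr_cons] at hj ⊢
    rw [add_comm]
    exact Q_iter hU hω i (α i) (by omega) (ih (by omega))

lemma mD_bound {n q : ℕ} {U : Set (Fin n → ℝ)} (hU : IsOpen U) {ω : (Fin n → ℝ) → ℝ}
    (hω : ContDiffOn ℝ (q : ℕ∞) ω U) (α : Fin n → ℕ) (hα : deg α ≤ q) {x : Fin n → ℝ}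
    (hx : x ∈ U) : |mD α ω x| ≤ ‖iteratedFDeriv ℝ (deg α) ω x‖ := by
  have hs : ((List.finRange n).map α).sum = deg α := by
    rw [deg, ← List.ofFn_eq_map, List.sum_ofFn]
  have := Q_list hU hω α (List.finRange n) (by omega)
  rw [hs] at this
  obtain ⟨v, hv, h⟩ := this
  have h2 := h x hx
  rw [mD, h2, ← Real.norm_eq_abs]
  refine (ContinuousMultilinearMap.le_opNorm _ _).trans ?_
  have : ∏ i, ‖v i‖ ≤ 1 := Finset.prod_le_one (fun i _ => norm_nonneg _) (fun i _ => hv i)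
  exact mul_le_of_le_one_right (norm_nonneg _) this

/-- the rescaled bump attached to a cube of scale `k` and position `m` -/
noncomputable def bmp {n : ℕ} (ψ : (Fin n → ℝ) → ℝ) (ε : ℝ) (p : (_ : ℤ) × (Fin n → ℤ))
    (x : Fin n → ℝ) : ℝ :=
  ψ ((ε * 2 ^ p.1)⁻¹ • x - fun i => (p.2 i : ℝ))

open Classical in
noncomputable def wt {n : ℕ} (ψ : (Fin n → ℝ) → ℝ) (T : Set ((_ : ℤ) × (Fin n → ℤ))) (ε : ℝ)
    (p : (_ : ℤ) × (Fin n → ℤ)) (x : Fin n → ℝ) : ℝ :=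
  if p ∈ T then bmp ψ ε p x else 0

lemma bmp_contDiff {n : ℕ} {ψ : (Fin n → ℝ) → ℝ} (q : ℕ) (hψ : ContDiff ℝ q ψ) (ε : ℝ)
    (p : (_ : ℤ) × (Fin n → ℤ)) : ContDiff ℝ q (bmp ψ ε p) := by
  unfold bmp
  fun_prop

lemma wt_contDiff {n : ℕ} {ψ : (Fin n → ℝ) → ℝ} (q : ℕ) (hψ : ContDiff ℝ q ψ) (T) (ε : ℝ)
    (p : (_ : ℤ) × (Fin n → ℤ)) : ContDiff ℝ q (wt ψ T ε p) := by
  unfold wt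
  split_ifs
  · exact bmp_contDiff q hψ ε p
  · exact contDiff_const

lemma bmp_bound {n : ℕ} {ψ : (Fin n → ℝ) → ℝ} {q : ℕ} (hψ : ContDiff ℝ q ψ) {M : ℝ}
    (hM : ∀ i ≤ q, ∀ x, ‖iteratedFDeriv ℝ i ψ x‖ ≤ M) {ε : ℝ} (hε : 0 < ε)
    (p : (_ : ℤ) × (Fin n → ℤ)) (i : ℕ) (hi : i ≤ q) (x) :
    ‖iteratedFDeriv ℝ i (bmp ψ ε p) x‖ ≤ ((ε * 2 ^ p.1)⁻¹) ^ i * M := by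
  have h0 : bmp ψ ε p = fun x => (fun z => ψ (z - fun i => (p.2 i : ℝ))) ((ε * 2 ^ p.1)⁻¹ • x) := rfl
  have hiq : (i : WithTop ℕ∞) ≤ q := by exact_mod_cast hi
  have hc : ContDiff ℝ i (fun z => ψ (z - fun i => (p.2 i : ℝ))) := by
    have := hψ.of_le hiq
    fun_prop
  rw [h0, iteratedFDeriv_comp_const_smul _ hc]
  simp only [norm_smul, norm_pow, iteratedFDeriv_comp_sub]
  have : ‖(ε * 2 ^ p.1)⁻¹‖ = (ε * 2 ^ p.1)⁻¹ := Real.norm_of_nonneg (by positivity)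
  rw [this]
  gcongr
  exact hM i hi _

lemma wt_bound {n : ℕ} {ψ : (Fin n → ℝ) → ℝ} {q : ℕ} (hψ : ContDiff ℝ q ψ) {M : ℝ}
    (hM : ∀ i ≤ q, ∀ x, ‖iteratedFDeriv ℝ i ψ x‖ ≤ M) {ε : ℝ} (hε : 0 < ε) (T)
    (p : (_ : ℤ) × (Fin n → ℤ)) (i : ℕ) (hi : i ≤ q) (x) :
    ‖iteratedFDeriv ℝ i (wt ψ T ε p) x‖ ≤ ((ε * 2 ^ p.1)⁻¹) ^ i * M := by
  have hM0 : 0 ≤ M := (norm_nonneg _).trans (hM 0 (Nat.zero_le _) 0)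
  by_cases h : p ∈ T
  · have : wt ψ T ε p = bmp ψ ε p := by ext; simp [wt, h]
    rw [this]; exact bmp_bound hψ hM hε p i hi x
  · have : wt ψ T ε p = 0 := by ext; simp [wt, h]
    rw [this]
    have h0 : iteratedFDeriv ℝ i (0 : (Fin n → ℝ) → ℝ) x = 0 := by
      rw [iteratedFDeriv_zero]; rfl
    rw [h0, norm_zero]; positivity

/-- the finite set of indices relevant near `x` -/
noncomputable def K {n : ℕ} (ε : ℝ) (x : Fin n → ℝ) (G : ℝ) : Finset ((_ : ℤ) × (Fin n → ℤ)) :=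
  (Finset.Icc (Int.log 2 G - 3) (Int.log 2 G + 3)).sigma fun k =>
    Fintype.piFinset fun i =>
      Finset.Icc (⌊(ε * 2 ^ k)⁻¹ * x i⌋ - 3) (⌊(ε * 2 ^ k)⁻¹ * x i⌋ + 4)

lemma K_card {n : ℕ} (ε : ℝ) (x : Fin n → ℝ) (G : ℝ) : (K ε x G).card = 7 * 8 ^ n := by
  have h1 : ∀ a : ℤ, (a + 4 + 1 - (a - 3)).toNat = 8 := by intro a; omega
  have h2 : ∀ a : ℤ, (a + 3 + 1 - (a - 3)).toNat = 7 := by intro a; omega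
  simp [K, Finset.card_sigma, Fintype.card_piFinset, h1, h2]

lemma K_mem {n : ℕ} {ε : ℝ} (hε : 0 < ε) {x y : Fin n → ℝ} {G H : ℝ} (hG : 0 < G)
    (hHG : |H - G| ≤ G / 10) (hxy : ‖y - x‖ ≤ ε * G / 10)
    (p : (_ : ℤ) × (Fin n → ℤ)) (h1 : H / 5 ≤ 2 ^ p.1) (h2 : (2 : ℝ) ^ p.1 ≤ 3 * H)
    (h3 : ‖(ε * 2 ^ p.1)⁻¹ • y - fun i => (p.2 i : ℝ)‖ < 2) : p ∈ K ε x G := by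
  obtain ⟨k, m⟩ := p
  simp only at h1 h2 h3
  have hl := Int.zpow_log_le_self (b := 2) one_lt_two hG
  have hu := Int.lt_zpow_succ_log_self (b := 2) one_lt_two G
  push_cast at hl hu
  rw [zpow_add_one₀ two_ne_zero] at hu
  obtain ⟨ha, hb⟩ := abs_le.1 hHG
  have hpow : (0 : ℝ) < 2 ^ Int.log 2 G := by positivity
  have hk1 : Int.log 2 G - 3 ≤ k := by
    have : (2 : ℝ) ^ (Int.log 2 G - 3) ≤ 2 ^ k := by
      rw [zpow_sub₀ two_ne_zero]; norm_num; linarith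
    exact (zpow_le_zpow_iff_right₀ one_lt_two).1 this
  have hk2 : k ≤ Int.log 2 G + 3 := by
    have : (2 : ℝ) ^ k ≤ 2 ^ (Int.log 2 G + 3) := by
      rw [zpow_add₀ two_ne_zero]; norm_num; linarith
    exact (zpow_le_zpow_iff_right₀ one_lt_two).1 this
  simp only [K, Finset.mem_sigma, Finset.mem_Icc, Fintype.mem_piFinset]
  refine ⟨⟨hk1, hk2⟩, fun i => ?_⟩
  have hi := (norm_le_pi_norm _ i).trans_lt h3
  simp only [Pi.sub_apply, Pi.smul_apply, smul_eq_mul, Real.norm_eq_abs] at hi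
  have hxi := (norm_le_pi_norm _ i).trans hxy
  simp only [Pi.sub_apply, Real.norm_eq_abs] at hxi
  have hs : (0 : ℝ) < ε * 2 ^ k := by positivity
  have hd : |(ε * 2 ^ k)⁻¹ * y i - (ε * 2 ^ k)⁻¹ * x i| ≤ 1 := by
    rw [← mul_sub, abs_mul, abs_of_pos (inv_pos.2 hs), inv_mul_le_iff₀ hs, mul_one]
    refine hxi.trans ?_
    rw [mul_div_assoc]
    gcongr
    linarith
  have f1 := Int.floor_le ((ε * 2 ^ k)⁻¹ * x i)
  have f2 := Int.lt_floor_add_one ((ε * 2 ^ k)⁻¹ * x i)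
  obtain ⟨c1, c2⟩ := abs_lt.1 hi
  obtain ⟨c3, c4⟩ := abs_le.1 hd
  constructor
  · have : (((⌊(ε * 2 ^ k)⁻¹ * x i⌋ - 3 : ℤ)) : ℝ) ≤ (m i : ℝ) := by push_cast; linarith
    exact_mod_cast this
  · have : (m i : ℝ) ≤ (((⌊(ε * 2 ^ k)⁻¹ * x i⌋ + 4 : ℤ)) : ℝ) := by push_cast; linarith
    exact_mod_cast this

lemma exists_bounds {n : ℕ} (q : ℕ) {ψ : (Fin n → ℝ) → ℝ} (hψ : ContDiff ℝ q ψ)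
    (hc : HasCompactSupport ψ) :
    ∃ M, 1 ≤ M ∧ ∀ i ≤ q, ∀ x, ‖iteratedFDeriv ℝ i ψ x‖ ≤ M := by
  have : ∀ i : ℕ, ∃ C, i ≤ q → ∀ x, ‖iteratedFDeriv ℝ i ψ x‖ ≤ C := by
    intro i
    by_cases hi : i ≤ q
    · obtain ⟨C, hC⟩ := (hc.iteratedFDeriv (𝕜 := ℝ) i).exists_bound_of_continuous
        (hψ.continuous_iteratedFDeriv (by exact_mod_cast hi))
      exact ⟨C, fun _ => hC⟩
    · exact ⟨0, fun h => absurd h hi⟩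
  choose C hC using this
  refine ⟨1 + ∑ i ∈ Finset.range (q + 1), |C i|, ?_, ?_⟩
  · have : 0 ≤ ∑ i ∈ Finset.range (q + 1), |C i| := Finset.sum_nonneg fun _ _ => abs_nonneg _
    linarith
  · intro i hi x
    have h1 := hC i hi x
    have h2 := Finset.single_le_sum (f := fun i => |C i|) (fun _ _ => abs_nonneg _)
      (Finset.mem_range.2 (Nat.lt_succ_of_le hi))
    have := le_abs_self (C i)
    linarith

lemma st_bounds (q : ℕ) (N : ℝ) :
    ∃ M, 1 ≤ M ∧ ∀ i ≤ q, ∀ x ∈ Set.Icc 0 N, ‖iteratedFDeriv ℝ i Real.smoothTransition x‖ ≤ M := by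
  have : ∀ i : ℕ, ∃ C, ∀ x ∈ Set.Icc 0 N, ‖iteratedFDeriv ℝ i Real.smoothTransition x‖ ≤ C := by
    intro i
    exact isCompact_Icc.exists_bound_of_continuousOn
      ((Real.smoothTransition.contDiff (n := i)).continuous_iteratedFDeriv le_rfl).continuousOn
  choose C hC using this
  refine ⟨1 + ∑ i ∈ Finset.range (q + 1), |C i|, ?_, ?_⟩
  · have : 0 ≤ ∑ i ∈ Finset.range (q + 1), |C i| := Finset.sum_nonneg fun _ _ => abs_nonneg _
    linarith
  · intro i hi x hx
    have h1 := hC i x hx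
    have h2 := Finset.single_le_sum (f := fun i => |C i|) (fun _ _ => abs_nonneg _)
      (Finset.mem_range.2 (Nat.lt_succ_of_le hi))
    have := le_abs_self (C i)
    linarith

/-- lattice point -/
noncomputable def pt {n : ℕ} (ε : ℝ) (p : (_ : ℤ) × (Fin n → ℤ)) : Fin n → ℝ :=
  (ε * 2 ^ p.1) • fun i => (p.2 i : ℝ)

lemma dist_pt {n : ℕ} {ε : ℝ} (hε : 0 < ε) (p : (_ : ℤ) × (Fin n → ℤ)) (x : Fin n → ℝ) :
    dist x (pt ε p) = (ε * 2 ^ p.1) * ‖(ε * 2 ^ p.1)⁻¹ • x - fun i => (p.2 i : ℝ)‖ := by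
  have hs : (0 : ℝ) < ε * 2 ^ p.1 := by positivity
  rw [dist_eq_norm]
  have h := norm_smul (ε * 2 ^ p.1) ((ε * 2 ^ p.1)⁻¹ • x - fun i => (p.2 i : ℝ))
  rw [Real.norm_of_nonneg hs.le] at h
  rw [← h, smul_sub, smul_inv_smul₀ hs.ne']
  rfl

theorem main {n : ℕ} (q : ℕ) (f g : (Fin n → ℝ) → ℝ)
    (hf : LipschitzWith 1 f) (hg : LipschitzWith 1 g) (U : Set (Fin n → ℝ)) (hU : IsOpen U)
    (hgU : ∀ x ∈ U, 0 < g x) (η : ℝ) (hη : 0 < η) :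
    ∃ C > 0, ∃ ω : (Fin n → ℝ) → ℝ,
      (∀ x, ω x ∈ Set.Icc (0 : ℝ) 1) ∧
      ContDiffOn ℝ (q : ℕ∞) ω U ∧
      (∀ x ∈ U, ∀ j ≤ q, ‖iteratedFDeriv ℝ j ω x‖ ≤ C / g x ^ j) ∧
      (∀ x ∈ U, f x < η / 32 * g x → ω x = 1) ∧
      (∀ x ∈ U, ω x ≠ 0 → f x ≤ η / 3 * g x) := by
  classical
  set ε : ℝ := min (1 / 16) (η / 32) with hεdef
  have hε : 0 < ε := lt_min (by norm_num) (by positivity)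
  have hε1 : ε ≤ 1 / 16 := min_le_left _ _
  have hε2 : ε ≤ η / 32 := min_le_right _ _
  let b : ContDiffBump (0 : Fin n → ℝ) := ⟨1, 2, one_pos, one_lt_two⟩
  set ψ : (Fin n → ℝ) → ℝ := fun x => b x with hψdef
  have hψ : ContDiff ℝ q ψ := by
    have : ContDiff ℝ ((q : ℕ∞) : WithTop ℕ∞) ψ := b.contDiff
    exact_mod_cast this
  have hψ1 : ∀ x, ‖x‖ ≤ 1 → ψ x = 1 := fun x hx => b.one_of_mem_closedBall (by simpa [b] using hx)
  have hψ2 : ∀ x, ψ x ≠ 0 → ‖x‖ < 2 := by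
    intro x hx
    by_contra h
    exact hx (b.zero_of_le_dist (by simpa [b] using h))
  have hψ01 : ∀ x, 0 ≤ ψ x ∧ ψ x ≤ 1 := fun x => ⟨b.nonneg, b.le_one⟩
  obtain ⟨M, hM1, hM⟩ := exists_bounds q hψ b.hasCompactSupport
  set T : Set ((_ : ℤ) × (Fin n → ℤ)) := {p | (2 : ℝ) ^ p.1 / 2 ≤ g (pt ε p) ∧
    g (pt ε p) ≤ 4 * 2 ^ p.1 ∧ f (pt ε p) < η / 8 * g (pt ε p)} with hT
  have hlf : ∀ x y, |f x - f y| ≤ dist x y := fun x y => by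
    simpa [Real.dist_eq] using hf.dist_le_mul x y
  have hlg : ∀ x y, |g x - g y| ≤ dist x y := fun x y => by
    simpa [Real.dist_eq] using hg.dist_le_mul x y
  have hw01 : ∀ p x, 0 ≤ wt ψ T ε p x ∧ wt ψ T ε p x ≤ 1 := by
    intro p x
    unfold wt bmp
    split_ifs
    · exact hψ01 _
    · norm_num
  -- scale facts
  have hscale : ∀ p x, wt ψ T ε p x ≠ 0 → g x / 5 ≤ 2 ^ p.1 ∧ (2 : ℝ) ^ p.1 ≤ 3 * g x ∧
      f x ≤ η / 3 * g x ∧ ‖(ε * 2 ^ p.1)⁻¹ • x - fun i => (p.2 i : ℝ)‖ < 2 := by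
    intro p x hp
    have hpT : p ∈ T := by
      by_contra h; exact hp (by simp [wt, h])
    have h2 : ‖(ε * 2 ^ p.1)⁻¹ • x - fun i => (p.2 i : ℝ)‖ < 2 := by
      apply hψ2
      simpa [wt, hpT, bmp] using hp
    obtain ⟨t1, t2, t3⟩ := hpT
    have hs : (0 : ℝ) < 2 ^ p.1 := by positivity
    have hd : dist x (pt ε p) ≤ 4 * ε * g (pt ε p) := by
      rw [dist_pt hε]
      have : ε * 2 ^ p.1 * ‖(ε * 2 ^ p.1)⁻¹ • x - fun i => (p.2 i : ℝ)‖ ≤ ε * 2 ^ p.1 * 2 := by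
        gcongr
      nlinarith
    have hgp : 0 < g (pt ε p) := by linarith
    have e1 : 4 * ε * g (pt ε p) ≤ g (pt ε p) / 4 := by nlinarith
    have e2 : 4 * ε * g (pt ε p) ≤ η / 8 * g (pt ε p) := by
      have := mul_le_mul_of_nonneg_right hε2 hgp.le
      nlinarith
    obtain ⟨a1, a2⟩ := abs_le.1 (hlf x (pt ε p))
    obtain ⟨a3, a4⟩ := abs_le.1 (hlg x (pt ε p))
    refine ⟨by linarith, by linarith, ?_, h2⟩
    have : g (pt ε p) ≤ 4 / 3 * g x := by linarith
    have h3 : η / 4 * g (pt ε p) ≤ η / 4 * (4 / 3 * g x) := by gcongr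
    linarith
  set N : ℝ := 7 * 8 ^ n with hN
  have hN1 : 1 ≤ N := by
    have : (1 : ℝ) ≤ 8 ^ n := one_le_pow₀ (by norm_num)
    linarith
  obtain ⟨M', hM'1, hM'⟩ := st_bounds q N
  set Φ : (Fin n → ℝ) → ℝ := fun x => ∑' p, wt ψ T ε p x with hΦ
  set S : (Fin n → ℝ) → (Fin n → ℝ) → ℝ := fun x0 x => ∑ p ∈ K ε x0 (g x0), wt ψ T ε p x with hSdef
  have hloc : ∀ x ∈ U, Φ =ᶠ[nhds x] S x := by
    intro x hx
    have hG := hgU x hx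
    filter_upwards [Metric.ball_mem_nhds x (ε := ε * g x / 10) (by positivity)] with y hy
    rw [Metric.mem_ball] at hy
    apply tsum_eq_sum
    intro p hp
    by_contra hne
    apply hp
    obtain ⟨s1, s2, -, s4⟩ := hscale p y hne
    refine K_mem hε hG ?_ ?_ p s1 s2 s4
    · refine (hlg y x).trans (hy.le.trans ?_)
      nlinarith
    · rw [← dist_eq_norm]; exact hy.le
  have hScd : ∀ x, ContDiff ℝ q (S x) := fun x => by
    apply ContDiff.sum
    intro p _
    exact wt_contDiff q hψ T ε p
  have hst : ContDiff ℝ q Real.smoothTransition := by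
    have : ContDiff ℝ ((q : ℕ∞) : WithTop ℕ∞) Real.smoothTransition := Real.smoothTransition.contDiff
    exact_mod_cast this
  have hSN : ∀ x y, S x y ∈ Set.Icc 0 N := by
    intro x y
    refine ⟨Finset.sum_nonneg fun p _ => (hw01 p y).1, ?_⟩
    refine (Finset.sum_le_card_nsmul _ _ 1 fun p _ => (hw01 p y).2).trans ?_
    rw [K_card]; simp [hN]
  set A : ℝ := N * M * (16 / ε) with hA
  have hNM : 1 ≤ N * M := one_le_mul_of_one_le_of_one_le hN1 hM1
  have hA1 : 1 ≤ A := by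
    refine one_le_mul_of_one_le_of_one_le hNM ?_
    rw [le_div_iff₀ hε]; linarith
  have hSder : ∀ x ∈ U, ∀ i, 1 ≤ i → i ≤ q → ‖iteratedFDeriv ℝ i (S x) x‖ ≤ (A / g x) ^ i := by
    intro x hx i hi1 hi
    have hG := hgU x hx
    have hiq : (i : WithTop ℕ∞) ≤ q := by exact_mod_cast hi
    rw [hSdef]
    simp only
    rw [iteratedFDeriv_fun_sum_apply
      (fun p _ => ((wt_contDiff q hψ T ε p).of_le hiq).contDiffAt)]
    refine (norm_sum_le _ _).trans ?_
    have : ∀ p ∈ K ε x (g x), ‖iteratedFDeriv ℝ i (wt ψ T ε p) x‖ ≤ (16 / ε / g x) ^ i * M := by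
      intro p hp
      refine (wt_bound hψ hM hε T p i hi x).trans ?_
      simp only [K, Finset.mem_sigma, Finset.mem_Icc] at hp
      have hk := hp.1.1
      have hu := Int.lt_zpow_succ_log_self (b := 2) one_lt_two (g x)
      push_cast at hu
      rw [zpow_add_one₀ two_ne_zero] at hu
      have h2 : (2 : ℝ) ^ (Int.log 2 (g x) - 3) ≤ 2 ^ p.1 :=
        zpow_le_zpow_right₀ one_le_two hk
      rw [zpow_sub₀ two_ne_zero] at h2
      norm_num at h2
      have h3 : g x / 16 ≤ 2 ^ p.1 := by linarith
      have h4 : (ε * 2 ^ p.1)⁻¹ ≤ 16 / ε / g x := by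
        rw [show 16 / ε / g x = (ε * (g x / 16))⁻¹ by field_simp]
        gcongr
      gcongr
    refine (Finset.sum_le_card_nsmul _ _ _ this).trans ?_
    rw [K_card, nsmul_eq_mul]
    push_cast
    rw [← hN, show A / g x = N * M * (16 / ε / g x) by rw [hA]; ring, mul_pow]
    calc N * ((16 / ε / g x) ^ i * M) = (N * M) * (16 / ε / g x) ^ i := by ring
      _ ≤ (N * M) ^ i * (16 / ε / g x) ^ i := by
        gcongr
        exact le_self_pow₀ hNM (by omega)
  have hωloc : ∀ x ∈ U, (Real.smoothTransition ∘ Φ) =ᶠ[nhds x] (Real.smoothTransition ∘ S x) :=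
    fun x hx => (hloc x hx).fun_comp _
  refine ⟨(q.factorial : ℝ) * M' * A ^ q, by positivity, Real.smoothTransition ∘ Φ, ?_, ?_, ?_, ?_, ?_⟩
  · exact fun x => ⟨Real.smoothTransition.nonneg _, Real.smoothTransition.le_one _⟩
  · intro x hx
    have : ContDiffAt ℝ q (Real.smoothTransition ∘ Φ) x :=
      (hst.comp (hScd x)).contDiffAt.congr_of_eventuallyEq (hωloc x hx)
    exact_mod_cast this.contDiffWithinAt
  · intro x hx j hj
    have hG := hgU x hx
    rw [((hωloc x hx).iteratedFDeriv ℝ j).eq_of_nhds]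
    have hjq : (j : WithTop ℕ∞) ≤ q := by exact_mod_cast hj
    refine (norm_iteratedFDeriv_comp_le hst (hScd x) hjq x (C := M') (D := A / g x)
      (fun i hi => hM' i (hi.trans hj) _ (hSN x x))
      (fun i h1 hi => hSder x hx i h1 (hi.trans hj))).trans ?_
    rw [div_pow, ← mul_div_assoc]
    gcongr
  · intro x hx hfx
    have hG := hgU x hx
    apply Real.smoothTransition.one_of_one_le
    have hl := Int.zpow_log_le_self (b := 2) one_lt_two hG
    have hu := Int.lt_zpow_succ_log_self (b := 2) one_lt_two (g x)
    push_cast at hl hu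
    rw [zpow_add_one₀ two_ne_zero] at hu
    set k := Int.log 2 (g x)
    let p : (_ : ℤ) × (Fin n → ℤ) := ⟨k, fun i => ⌊(ε * 2 ^ k)⁻¹ * x i⌋⟩
    have hs : (0 : ℝ) < 2 ^ k := by positivity
    have hnorm : ‖(ε * 2 ^ p.1)⁻¹ • x - fun i => (p.2 i : ℝ)‖ ≤ 1 := by
      rw [pi_norm_le_iff_of_nonneg zero_le_one]
      intro i
      simp only [p, Pi.sub_apply, Pi.smul_apply, smul_eq_mul, Real.norm_eq_abs]
      rw [abs_le]
      constructor <;>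
      linarith [Int.floor_le ((ε * 2 ^ k)⁻¹ * x i), Int.lt_floor_add_one ((ε * 2 ^ k)⁻¹ * x i)]
    have hd : dist x (pt ε p) ≤ ε * 2 ^ k := by
      rw [dist_pt hε]
      exact mul_le_of_le_one_right (by positivity) hnorm
    obtain ⟨a1, a2⟩ := abs_le.1 (hlf x (pt ε p))
    obtain ⟨a3, a4⟩ := abs_le.1 (hlg x (pt ε p))
    have e1 : ε * 2 ^ k ≤ 2 ^ k / 16 := by nlinarith
    have e2 : ε * 2 ^ k ≤ η / 32 * g x := by gcongr
    have hpT : p ∈ T := by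
      refine ⟨?_, ?_, ?_⟩
      · change (2 : ℝ) ^ k / 2 ≤ _; linarith
      · change _ ≤ 4 * (2 : ℝ) ^ k; linarith
      · have : g x ≤ 16 / 15 * g (pt ε p) := by linarith
        have h3 : η / 16 * g x ≤ η / 16 * (16 / 15 * g (pt ε p)) := by gcongr
        have hgp : 0 < η * g (pt ε p) := mul_pos hη (by linarith)
        linarith
    have hw : wt ψ T ε p x = 1 := by
      rw [wt, if_pos hpT, bmp, hψ1 _ hnorm]
    have hpK : p ∈ K ε x (g x) := by
      obtain ⟨s1, s2, -, s4⟩ := hscale p x (by rw [hw]; exact one_ne_zero)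
      exact K_mem hε hG (by simp; positivity) (by simp; positivity) p s1 s2 s4
    rw [(hloc x hx).eq_of_nhds, ← hw]
    exact Finset.single_le_sum (f := fun p => wt ψ T ε p x) (fun p _ => (hw01 p x).1) hpK
  · intro x hx hne
    by_contra hcon
    apply hne
    have : Φ x = 0 := by
      rw [hΦ]
      simp only
      rw [show (fun p => wt ψ T ε p x) = 0 from ?_]
      · exact tsum_zero
      · ext p
        by_contra h
        exact hcon (hscale p x h).2.2.1
    simp [this]

lemma d1_lip {n : ℕ} (S : Set (Fin n → ℝ)) : LipschitzWith 1 (fun x => d1 x S) := by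
  unfold d1
  by_cases h : S.Nonempty
  · simpa [h] using Metric.lipschitz_infDist_pt S
  · simpa [h] using LipschitzWith.const' (1 : ℝ)

end CqUry

/-- **Theorem 3.2 (C^q-Urysohn lemma, without definability).** For `Z ⊆ ℝⁿ` closed,
`W` closed in `ℝⁿ \ Z`, `q ≥ 1` and `η > 0`, there are `C > 0`, `ρ ∈ (0, η)` and a `C^q`
function `ω : ℝⁿ \ Z → [0,1]` with `|D^α ω(x)| ≤ C/d(x,Z)^|α|` for `|α| ≤ q`, `ω ≡ 1` on
`G_ρ(W, Z)`, and support (in `ℝⁿ \ Z`) contained in `G_η(W, Z)`. -/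
theorem cq_urysohn (n q : ℕ) (hq : 1 ≤ q)
    (Z : Set (Fin n → ℝ)) (hZ : IsClosed Z)
    (W : Set (Fin n → ℝ)) (hWZ : W ⊆ Zᶜ) (hWcl : closure W ∩ Zᶜ ⊆ W)
    (η : ℝ) (hη : 0 < η) :
    ∃ C > 0, ∃ ρ ∈ Set.Ioo 0 η, ∃ ω : (Fin n → ℝ) → ℝ,
      (∀ x ∉ Z, ω x ∈ Set.Icc (0 : ℝ) 1) ∧
      ContDiffOn ℝ (q : ℕ∞) ω Zᶜ ∧
      (∀ x ∉ Z, ∀ α : Fin n → ℕ, deg α ≤ q → |mD α ω x| ≤ C / d1 x Z ^ deg α) ∧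
      (∀ x ∈ Gnbhd ρ W Z, ω x = 1) ∧
      closure {x | x ∉ Z ∧ ω x ≠ 0} ∩ Zᶜ ⊆ Gnbhd η W Z := by
  obtain ⟨C, hC, ω, h1, h2, h3, h4, h5⟩ := CqUry.main q (fun x => d1 x W) (fun x => d1 x Z)
    (CqUry.d1_lip W) (CqUry.d1_lip Z) Zᶜ hZ.isOpen_compl (by
      intro x hx
      unfold d1
      split_ifs with h
      · exact (hZ.notMem_iff_infDist_pos h).1 hx
      · exact one_pos) η hη
  have hpos : ∀ x ∈ Zᶜ, 0 < d1 x Z := by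
    intro x hx
    unfold d1
    split_ifs with h
    · exact (hZ.notMem_iff_infDist_pos h).1 hx
    · exact one_pos
  refine ⟨C, hC, η / 32, ⟨by positivity, by linarith⟩, ω, fun x _ => h1 x, h2, ?_, ?_, ?_⟩
  · intro x hx α hα
    exact (CqUry.mD_bound hZ.isOpen_compl h2 α hα hx).trans (h3 x hx _ hα)
  · exact fun x hx => h4 x hx.1 hx.2
  · rintro x ⟨hx, hxZ⟩
    refine ⟨hxZ, ?_⟩
    have hcl : IsClosed {x : Fin n → ℝ | d1 x W ≤ η / 3 * d1 x Z} :=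
      isClosed_le (CqUry.d1_lip W).continuous (continuous_const.mul (CqUry.d1_lip Z).continuous)
    have hm : x ∈ {x : Fin n → ℝ | d1 x W ≤ η / 3 * d1 x Z} :=
      closure_minimal (fun y hy => h5 y hy.1 hy.2) hcl hx
    have hm' : d1 x W ≤ η / 3 * d1 x Z := hm
    have := mul_pos hη (hpos x hxZ)
    linarith
end

section
/- Let p be a positive integer, let A ⊆ ℝⁿ and B ⊆ ℝ^m be locally closed, let F₁, …, F_m be C^p-Whitney fields on A and let H be a C^p-Whitney field on B. Assume that (F₁⁰(u), …, F_m⁰(u)) ∈ B for every u ∈ A, where F_j⁰ denotes the coefficient of F_j indexed by the zero multi-index. Then the composition H ∘ F, defined for u ∈ A as the polynomial (H ∘ F)(u, X) := π_p[ H( F₁⁰(u), …, F_m⁰(u); F₁(u, X) − F₁⁰(u), …, F_m(u, X) − F_m⁰(u) ) ], where π_p denotes truncation to degree ≤ p in X, is a C^p-Whitney field on A. -/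
open scoped BigOperators NNReal

/-- The (finite) set of multi-indices `α : Fin n → ℕ` with `|α| ≤ k`. -/
noncomputable def multiIdx (n k : ℕ) : Finset (Fin n → ℕ) :=
  ((Finset.univ : Finset (Fin n → Fin (k + 1))).image
    (fun f i => (f i : ℕ))).filter (fun α => deg α ≤ k)

/-- A `C^p`-Whitney field on `A ⊆ ℝⁿ`: a family of continuous functions `F^α`, `|α| ≤ p`,
satisfying the Whitney compatibility condition
`F^β(a) - ∑_{|α| ≤ p - |β|} (1/α!) F^(α+β)(b) (a-b)^α = o(|a-b|^(p-|β|))` as `a, b → c` in `A`. -/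
def IsWhitneyField (n p : ℕ) (A : Set (Fin n → ℝ))
    (F : (Fin n → ℕ) → (Fin n → ℝ) → ℝ) : Prop :=
  (∀ α : Fin n → ℕ, deg α ≤ p → ContinuousOn (F α) A) ∧
  ∀ c ∈ A, ∀ β : Fin n → ℕ, deg β ≤ p → ∀ ε > 0, ∃ δ > 0,
    ∀ a ∈ A, ∀ b ∈ A, dist a c < δ → dist b c < δ →
      |F β a - ∑ α ∈ multiIdx n (p - deg β),
          (1 / (mfact α : ℝ)) * F (α + β) b * ∏ i, (a i - b i) ^ α i|
        ≤ ε * dist a b ^ (p - deg β)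

/-- A multi-index `Fin n → ℕ` as a finitely supported function. -/
noncomputable def toFinsupp {n : ℕ} (α : Fin n → ℕ) : Fin n →₀ ℕ :=
  Finsupp.equivFunOnFinite.symm α

/-- Truncation `π_p`: keep only the monomials of total degree `≤ p`. -/
noncomputable def truncP {n : ℕ} (p : ℕ) (P : MvPolynomial (Fin n) ℝ) :
    MvPolynomial (Fin n) ℝ :=
  ∑ s ∈ P.support.filter (fun s => (∑ i, s i) ≤ p), MvPolynomial.monomial s (P.coeff s)

/-- The polynomial `F(u, X) = ∑_{|α| ≤ p} (1/α!) F^α(u) X^α` of a Whitney field at `u`. -/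
noncomputable def fieldPoly {n : ℕ} (p : ℕ) (F : (Fin n → ℕ) → (Fin n → ℝ) → ℝ)
    (u : Fin n → ℝ) : MvPolynomial (Fin n) ℝ :=
  ∑ α ∈ multiIdx n p, MvPolynomial.monomial (toFinsupp α) ((1 / (mfact α : ℝ)) * F α u)


open Filter Topology Asymptotics MvPolynomial

namespace WhitneyAux

lemma mem_multiIdx {n k : ℕ} (α : Fin n → ℕ) : α ∈ multiIdx n k ↔ deg α ≤ k := by
  unfold multiIdx
  simp only [Finset.mem_filter, Finset.mem_image, Finset.mem_univ, true_and, and_iff_right_iff_imp]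
  intro h
  refine ⟨fun i => ⟨α i, ?_⟩, rfl⟩
  have : α i ≤ deg α := Finset.single_le_sum (f := α) (fun _ _ => Nat.zero_le _) (Finset.mem_univ i)
  omega

lemma deg_add {n : ℕ} (α β : Fin n → ℕ) : deg (α + β) = deg α + deg β := by
  simp [deg, Finset.sum_add_distrib]

lemma toFinsupp_apply {n : ℕ} (α : Fin n → ℕ) (i : Fin n) : toFinsupp α i = α i := rfl

lemma toFinsupp_coe {n : ℕ} (s : Fin n →₀ ℕ) : toFinsupp (⇑s) = s := by
  ext i; rfl

lemma toFinsupp_inj {n : ℕ} {α β : Fin n → ℕ} : toFinsupp α = toFinsupp β ↔ α = β :=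
  Finsupp.equivFunOnFinite.symm.injective.eq_iff

lemma mfact_ne {n : ℕ} (α : Fin n → ℕ) : (mfact α : ℝ) ≠ 0 := by
  unfold mfact
  exact_mod_cast Finset.prod_ne_zero_iff.2 fun i _ => Nat.factorial_ne_zero _

lemma coeff_fieldPoly {n p : ℕ} (F : (Fin n → ℕ) → (Fin n → ℝ) → ℝ) (u : Fin n → ℝ)
    (β : Fin n → ℕ) : coeff (toFinsupp β) (fieldPoly p F u) =
      if deg β ≤ p then (1 / (mfact β : ℝ)) * F β u else 0 := by
  classical
  unfold fieldPoly
  rw [coeff_sum]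
  simp only [coeff_monomial, toFinsupp_inj]
  rw [Finset.sum_ite_eq']
  simp [mem_multiIdx]

lemma prod_X_pow {n : ℕ} (k : Fin n → ℕ) :
    (∏ i, (X i : MvPolynomial (Fin n) ℝ) ^ k i) = monomial (toFinsupp k) 1 := by
  rw [monomial_eq]
  simp [Finsupp.prod_fintype, toFinsupp_apply]

lemma monomial_toFinsupp {n : ℕ} (k : Fin n → ℕ) (r : ℝ) :
    monomial (toFinsupp k) r = C r * ∏ i, (X i : MvPolynomial (Fin n) ℝ) ^ k i := by
  rw [prod_X_pow, C_mul_monomial, mul_one]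

lemma aeval_fieldPoly {n : ℕ} {m : ℕ} (p : ℕ) (F : (Fin n → ℕ) → (Fin n → ℝ) → ℝ)
    (u : Fin n → ℝ) (V : Fin n → MvPolynomial (Fin m) ℝ) :
    aeval V (fieldPoly p F u) =
      ∑ α ∈ multiIdx n p, C ((1 / (mfact α : ℝ)) * F α u) * ∏ j, V j ^ α j := by
  unfold fieldPoly
  rw [map_sum]
  refine Finset.sum_congr rfl fun α _ => ?_
  rw [monomial_toFinsupp, map_mul, map_prod]
  simp [algHom_C]

/-- translation of a polynomial -/
noncomputable def tr {n : ℕ} (h : Fin n → ℝ) :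
    MvPolynomial (Fin n) ℝ →ₐ[ℝ] MvPolynomial (Fin n) ℝ :=
  aeval (fun i => X i + C (h i))

lemma coeff_tr_prod {n : ℕ} (h : Fin n → ℝ) (γ β : Fin n → ℕ) :
    coeff (toFinsupp β) (∏ i, (X i + C (h i) : MvPolynomial (Fin n) ℝ) ^ γ i) =
      ∏ i, (h i ^ (γ i - β i) * ((γ i).choose (β i) : ℝ)) := by
  classical
  have e : ∀ i, (X i + C (h i) : MvPolynomial (Fin n) ℝ) ^ γ i =
      ∑ k ∈ Finset.range (γ i + 1), C (h i ^ (γ i - k) * ((γ i).choose k : ℝ)) * X i ^ k := by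
    intro i
    rw [add_pow]
    refine Finset.sum_congr rfl fun k _ => ?_
    simp only [map_mul, map_pow, map_natCast]
    ring
  simp_rw [e]
  rw [Finset.prod_univ_sum, coeff_sum]
  simp_rw [Finset.prod_mul_distrib, prod_X_pow]
  simp_rw [← map_prod, C_mul_monomial, coeff_monomial, toFinsupp_inj]
  rw [Finset.sum_ite_eq']
  split_ifs with hm
  · simp [Finset.prod_mul_distrib]
  · simp only [Fintype.mem_piFinset, Finset.mem_range, not_forall, not_lt] at hm
    obtain ⟨i, hi⟩ := hm
    rw [← Finset.prod_mul_distrib]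
    symm
    apply Finset.prod_eq_zero (Finset.mem_univ i)
    rw [Nat.choose_eq_zero_of_lt (by omega)]; simp

lemma coeff_tr_fieldPoly {n p : ℕ} (F : (Fin n → ℕ) → (Fin n → ℝ) → ℝ) (u h : Fin n → ℝ)
    (β : Fin n → ℕ) : coeff (toFinsupp β) (tr h (fieldPoly p F u)) =
      if deg β ≤ p then (1 / (mfact β : ℝ)) * ∑ α ∈ multiIdx n (p - deg β),
          (1 / (mfact α : ℝ)) * F (α + β) u * ∏ i, (h i) ^ α i else 0 := by
  classical
  unfold tr
  rw [aeval_fieldPoly, coeff_sum]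
  simp_rw [coeff_C_mul, coeff_tr_prod]
  have hz : ∀ γ : Fin n → ℕ, ¬ (β ≤ γ) →
      1 / (mfact γ : ℝ) * F γ u * ∏ i, (h i ^ (γ i - β i) * ((γ i).choose (β i) : ℝ)) = 0 := by
    intro γ hγ
    obtain ⟨i, hi⟩ := not_forall.1 hγ
    rw [Finset.prod_eq_zero (Finset.mem_univ i), mul_zero]
    rw [Nat.choose_eq_zero_of_lt (not_le.1 hi)]; simp
  split_ifs with hβ
  · rw [Finset.mul_sum]
    rw [← Finset.sum_filter_of_ne (s := multiIdx n p) (p := fun γ => β ≤ γ)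
      (fun γ _ hne => by by_contra hc; exact hne (hz γ hc))]
    symm
    refine Finset.sum_bij (fun α _ => α + β) ?_ ?_ ?_ ?_
    · intro α hα
      rw [mem_multiIdx] at hα
      rw [Finset.mem_filter, mem_multiIdx, deg_add]
      exact ⟨by omega, le_add_of_nonneg_left (zero_le)⟩
    · intro a _ b _ hab
      exact add_right_cancel hab
    · intro γ hγ
      rw [Finset.mem_filter, mem_multiIdx] at hγ
      have e : γ - β + β = γ := by
        funext i
        have : β i ≤ γ i := hγ.2 i
        simp only [Pi.add_apply, Pi.sub_apply]; omega
      refine ⟨γ - β, ?_, e⟩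
      rw [mem_multiIdx]
      have := deg_add (γ - β) β
      rw [e] at this
      omega
    · intro α _
      have key : (mfact (α + β) : ℝ) =
          mfact α * mfact β * ∏ i, (((α + β) i).choose (β i) : ℝ) := by
        unfold mfact
        push_cast
        rw [← Finset.prod_mul_distrib, ← Finset.prod_mul_distrib]
        refine Finset.prod_congr rfl fun i _ => ?_
        have := Nat.add_choose_mul_factorial_mul_factorial (α i) (β i)
        rw [Pi.add_apply, ← this]
        push_cast
        ring
      have h0 := mfact_ne (α + β)
      have h1 := mfact_ne α
      have h2 := mfact_ne β
      rw [Finset.prod_mul_distrib]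
      have e : (∏ i, h i ^ ((α + β) i - β i)) = ∏ i, h i ^ α i := by simp
      rw [e]
      have h3 : (∏ i, (((α + β) i).choose (β i) : ℝ)) = mfact (α + β) / (mfact α * mfact β) := by
        rw [key]; field_simp
      rw [h3]
      field_simp
  · refine Finset.sum_eq_zero fun γ hγ => hz γ fun hle => hβ ?_
    rw [mem_multiIdx] at hγ
    exact le_trans (Finset.sum_le_sum fun i _ => hle i) hγ

/-- coefficientwise continuity -/
def CC {Z : Type*} [TopologicalSpace Z] {n : ℕ} (S : Set Z) (P : Z → MvPolynomial (Fin n) ℝ) :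
    Prop := ∀ s, ContinuousOn (fun z => coeff s (P z)) S

section CCsec
variable {Z : Type*} [TopologicalSpace Z] {n : ℕ} {S : Set Z}

lemma CC.add {P Q : Z → MvPolynomial (Fin n) ℝ} (hP : CC S P) (hQ : CC S Q) :
    CC S (fun z => P z + Q z) := fun s => by
  simp only [coeff_add]; exact (hP s).add (hQ s)

lemma CC.sub {P Q : Z → MvPolynomial (Fin n) ℝ} (hP : CC S P) (hQ : CC S Q) :
    CC S (fun z => P z - Q z) := fun s => by
  simp only [coeff_sub]; exact (hP s).sub (hQ s)

lemma CC.mul {P Q : Z → MvPolynomial (Fin n) ℝ} (hP : CC S P) (hQ : CC S Q) :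
    CC S (fun z => P z * Q z) := fun s => by
  classical
  simp only [coeff_mul]
  exact continuousOn_finsetSum _ fun x _ => (hP x.1).mul (hQ x.2)

lemma CC.const (P : MvPolynomial (Fin n) ℝ) : CC S (fun _ => P) := fun _ => continuousOn_const

lemma CC.C {f : Z → ℝ} (hf : ContinuousOn f S) :
    CC S (fun z => (MvPolynomial.C (f z) : MvPolynomial (Fin n) ℝ)) := fun s => by
  classical
  simp only [coeff_C]
  split_ifs
  · exact hf
  · exact continuousOn_const

lemma CC.pow {P : Z → MvPolynomial (Fin n) ℝ} (hP : CC S P) (k : ℕ) :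
    CC S (fun z => P z ^ k) := by
  induction k with
  | zero => simpa using CC.const 1
  | succ k ih => simp only [pow_succ]; exact ih.mul hP

lemma CC.prod {ι : Type*} (t : Finset ι) {P : ι → Z → MvPolynomial (Fin n) ℝ}
    (hP : ∀ i ∈ t, CC S (P i)) : CC S (fun z => ∏ i ∈ t, P i z) := by
  classical
  induction t using Finset.induction_on with
  | empty => simpa using CC.const 1
  | insert a t ha ih =>
    simp only [Finset.prod_insert ha]
    exact (hP a (by simp)).mul (ih fun i hi => hP i (by simp [hi]))

lemma CC.sum {ι : Type*} (t : Finset ι) {P : ι → Z → MvPolynomial (Fin n) ℝ}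
    (hP : ∀ i ∈ t, CC S (P i)) : CC S (fun z => ∑ i ∈ t, P i z) := fun s => by
  simp only [coeff_sum]
  exact continuousOn_finsetSum _ fun i hi => hP i hi s

lemma CC.aeval {m p : ℕ} {F : (Fin m → ℕ) → (Fin m → ℝ) → ℝ} {g : Z → Fin m → ℝ}
    {V : Fin m → Z → MvPolynomial (Fin n) ℝ} (hV : ∀ j, CC S (V j))
    (hF : ∀ α, deg α ≤ p → ContinuousOn (fun z => F α (g z)) S) :
    CC S (fun z => MvPolynomial.aeval (fun j => V j z) (fieldPoly p F (g z))) := by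
  simp only [aeval_fieldPoly]
  refine CC.sum _ fun α hα => ?_
  rw [mem_multiIdx] at hα
  exact (CC.C (continuousOn_const.mul (hF α hα))).mul (CC.prod _ fun j _ => (hV j).pow _)

lemma CC.fieldPoly {p : ℕ} {F : (Fin n → ℕ) → (Fin n → ℝ) → ℝ} {g : Z → Fin n → ℝ}
    (hF : ∀ α, deg α ≤ p → ContinuousOn (fun z => F α (g z)) S) :
    CC S (fun z => fieldPoly p F (g z)) := by
  have := CC.aeval (n := n) (V := fun j _ => X j) (fun j => CC.const _) hF
  simpa using this

lemma CC.isBigO {P : Z → MvPolynomial (Fin n) ℝ} (hP : CC S P) {c : Z} (hc : c ∈ S) (s) :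
    (fun z => coeff s (P z)) =O[𝓝[S] c] (fun _ => (1 : ℝ)) :=
  (hP s c hc).isBigO_one ℝ

end CCsec

/-- the filter `a, b → c` in `A`. -/
def fl {n : ℕ} (A : Set (Fin n → ℝ)) (c : Fin n → ℝ) : Filter ((Fin n → ℝ) × (Fin n → ℝ)) :=
  𝓝[A ×ˢ A] (c, c)

/-- smallness -/
def Sm {n k : ℕ} (p : ℕ) (A : Set (Fin n → ℝ)) (c : Fin n → ℝ)
    (P : (Fin n → ℝ) × (Fin n → ℝ) → MvPolynomial (Fin k) ℝ) : Prop :=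
  ∀ s : Fin k →₀ ℕ, deg ⇑s ≤ p →
    (fun z => coeff s (P z)) =o[fl A c] (fun z => dist z.1 z.2 ^ (p - deg ⇑s))

lemma dist_tendsto {n : ℕ} (A : Set (Fin n → ℝ)) (c : Fin n → ℝ) :
    Tendsto (fun z : (Fin n → ℝ) × (Fin n → ℝ) => dist z.1 z.2) (fl A c) (𝓝 0) := by
  have : Continuous (fun z : (Fin n → ℝ) × (Fin n → ℝ) => dist z.1 z.2) := by fun_prop
  have h := this.tendsto (c, c)
  simp only [dist_self] at h
  exact h.mono_left nhdsWithin_le_nhds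

lemma dist_pow_bigO {n : ℕ} (A : Set (Fin n → ℝ)) (c : Fin n → ℝ) {i j : ℕ} (h : i ≤ j) :
    (fun z : (Fin n → ℝ) × (Fin n → ℝ) => dist z.1 z.2 ^ j) =O[fl A c]
      (fun z => dist z.1 z.2 ^ i) := by
  obtain ⟨d, rfl⟩ := Nat.exists_eq_add_of_le h
  simp only [pow_add]
  have h1 : (fun z : (Fin n → ℝ) × (Fin n → ℝ) => dist z.1 z.2 ^ d) =O[fl A c]
      (fun _ => (1 : ℝ)) := ((dist_tendsto A c).pow d).isBigO_one ℝ
  simpa using (isBigO_refl (fun z : (Fin n → ℝ) × (Fin n → ℝ) => dist z.1 z.2 ^ i) (fl A c)).mul h1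

lemma dist_pow_littleO {n : ℕ} (A : Set (Fin n → ℝ)) (c : Fin n → ℝ) {i j : ℕ} (h : i < j) :
    (fun z : (Fin n → ℝ) × (Fin n → ℝ) => dist z.1 z.2 ^ j) =o[fl A c]
      (fun z => dist z.1 z.2 ^ i) := by
  obtain ⟨d, rfl⟩ := Nat.exists_eq_add_of_le h
  have h0 : (fun z : (Fin n → ℝ) × (Fin n → ℝ) => dist z.1 z.2) =o[fl A c]
      (fun _ => (1 : ℝ)) := (isLittleO_one_iff ℝ).2 (dist_tendsto A c)
  have h1 := (isBigO_refl (fun z : (Fin n → ℝ) × (Fin n → ℝ) => dist z.1 z.2 ^ i)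
    (fl A c)).mul_isLittleO h0
  simp only [mul_one] at h1
  refine (dist_pow_bigO A c (show i + 1 ≤ i + 1 + d by omega)).trans_isLittleO ?_
  simpa only [pow_succ] using h1

section Smsec
variable {n k p : ℕ} {A : Set (Fin n → ℝ)} {c : Fin n → ℝ}
  {P Q P' Q' : (Fin n → ℝ) × (Fin n → ℝ) → MvPolynomial (Fin k) ℝ}

lemma Sm.add (hP : Sm p A c P) (hQ : Sm p A c Q) : Sm p A c (fun z => P z + Q z) := fun s hs => by
  simp only [coeff_add]; exact (hP s hs).add (hQ s hs)

lemma Sm.sub (hP : Sm p A c P) (hQ : Sm p A c Q) : Sm p A c (fun z => P z - Q z) := fun s hs => by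
  simp only [coeff_sub]; exact (hP s hs).sub (hQ s hs)

lemma Sm.sum {ι : Type*} (t : Finset ι)
    {P : ι → (Fin n → ℝ) × (Fin n → ℝ) → MvPolynomial (Fin k) ℝ}
    (hP : ∀ i ∈ t, Sm p A c (P i)) : Sm p A c (fun z => ∑ i ∈ t, P i z) := fun s hs => by
  simp only [coeff_sum]
  exact IsLittleO.fun_sum fun i hi => hP i hi s hs

lemma Sm.zero : Sm p A c (fun _ => (0 : MvPolynomial (Fin k) ℝ)) := fun s _ => by
  simp only [coeff_zero]; exact isLittleO_zero _ _

lemma Sm.congr (hP : Sm p A c P) (h : ∀ a ∈ A, ∀ b ∈ A, P (a, b) = Q (a, b)) : Sm p A c Q :=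
    fun s hs => by
  refine (hP s hs).congr' ?_ EventuallyEq.rfl
  filter_upwards [self_mem_nhdsWithin] with z hz
  rw [show z = (z.1, z.2) from rfl, h _ hz.1 _ hz.2]

lemma Sm.mul (hc : c ∈ A) (hP : Sm p A c P) (hQ : CC (A ×ˢ A) Q) :
    Sm p A c (fun z => P z * Q z) := fun s hs => by
  classical
  simp only [coeff_mul]
  refine IsLittleO.fun_sum fun x hx => ?_
  replace hx := Finset.HasAntidiagonal.mem_antidiagonal.1 hx
  have hd : deg ⇑x.1 ≤ deg ⇑s := by
    rw [← hx]
    exact Finset.sum_le_sum fun i _ => by simp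
  have h1 := (hP x.1 (hd.trans hs)).mul_isBigO (hQ.isBigO (c := (c, c)) ⟨hc, hc⟩ x.2)
  simp only [mul_one] at h1
  exact h1.trans_isBigO (dist_pow_bigO A c (by omega))

lemma Sm.mul_sub (hc : c ∈ A) (h1 : Sm p A c (fun z => P z - P' z))
    (h2 : Sm p A c (fun z => Q z - Q' z)) (hQ : CC (A ×ˢ A) Q) (hP' : CC (A ×ˢ A) P') :
    Sm p A c (fun z => P z * Q z - P' z * Q' z) := by
  refine ((h1.mul hc hQ).add (h2.mul hc hP')).congr fun a _ b _ => ?_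
  ring

lemma Sm.pow_sub (hc : c ∈ A) (h1 : Sm p A c (fun z => P z - P' z))
    (hP : CC (A ×ˢ A) P) (hP' : CC (A ×ˢ A) P') (k : ℕ) :
    Sm p A c (fun z => P z ^ k - P' z ^ k) := by
  induction k with
  | zero => simpa using Sm.zero
  | succ k ih => simp only [pow_succ]; exact ih.mul_sub hc h1 hP (hP'.pow k)

lemma Sm.prod_sub {ι : Type*} (hc : c ∈ A) (t : Finset ι)
    {P P' : ι → (Fin n → ℝ) × (Fin n → ℝ) → MvPolynomial (Fin k) ℝ}
    (h1 : ∀ i, Sm p A c (fun z => P i z - P' i z))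
    (hP : ∀ i, CC (A ×ˢ A) (P i)) (hP' : ∀ i, CC (A ×ˢ A) (P' i)) :
    Sm p A c (fun z => ∏ i ∈ t, P i z - ∏ i ∈ t, P' i z) := by
  classical
  induction t using Finset.induction_on with
  | empty => simpa using Sm.zero
  | insert a t ha ih =>
    simp only [Finset.prod_insert ha]
    exact (h1 a).mul_sub hc ih (CC.prod _ fun i _ => hP i) (hP' a)

end Smsec

/-- vanishing order at least `k` -/
def Ord {n : ℕ} (k : ℕ) (P : MvPolynomial (Fin n) ℝ) : Prop :=
  ∀ s : Fin n →₀ ℕ, deg ⇑s < k → coeff s P = 0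

lemma Ord.mul {n j k : ℕ} {P Q : MvPolynomial (Fin n) ℝ} (hP : Ord j P) (hQ : Ord k Q) :
    Ord (j + k) (P * Q) := fun s hs => by
  classical
  rw [coeff_mul]
  refine Finset.sum_eq_zero fun x hx => ?_
  replace hx := Finset.HasAntidiagonal.mem_antidiagonal.1 hx
  have e : deg ⇑s = deg ⇑x.1 + deg ⇑x.2 := by rw [← deg_add, ← hx]; rfl
  by_cases h : deg ⇑x.1 < j
  · rw [hP _ h, zero_mul]
  · rw [hQ _ (by omega), mul_zero]

lemma Ord.zero {n : ℕ} (P : MvPolynomial (Fin n) ℝ) : Ord 0 P := fun s hs => by omega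

lemma Ord.pow {n : ℕ} {P : MvPolynomial (Fin n) ℝ} (hP : Ord 1 P) (k : ℕ) : Ord k (P ^ k) := by
  induction k with
  | zero => exact Ord.zero _
  | succ k ih => rw [pow_succ]; exact ih.mul hP

lemma Ord.prod {n : ℕ} {ι : Type*} (t : Finset ι) {V : ι → MvPolynomial (Fin n) ℝ}
    (hV : ∀ j, Ord 1 (V j)) (γ : ι → ℕ) : Ord (∑ j ∈ t, γ j) (∏ j ∈ t, V j ^ γ j) := by
  classical
  induction t using Finset.induction_on with
  | empty => simpa using Ord.zero _
  | insert a t ha ih =>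
    rw [Finset.prod_insert ha, Finset.sum_insert ha]
    exact ((hV a).pow _).mul ih

lemma isWhitney_iff {n p : ℕ} {A : Set (Fin n → ℝ)} {F : (Fin n → ℕ) → (Fin n → ℝ) → ℝ} :
    IsWhitneyField n p A F ↔ (∀ α : Fin n → ℕ, deg α ≤ p → ContinuousOn (F α) A) ∧
      ∀ c ∈ A, Sm p A c (fun z => fieldPoly p F z.1 - tr (z.1 - z.2) (fieldPoly p F z.2)) := by
  unfold IsWhitneyField
  refine and_congr_right fun _ => forall₂_congr fun c hc => ?_
  have key : ∀ β : Fin n → ℕ, deg β ≤ p → ∀ z : (Fin n → ℝ) × (Fin n → ℝ),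
      coeff (toFinsupp β) (fieldPoly p F z.1 - tr (z.1 - z.2) (fieldPoly p F z.2)) =
      (1 / (mfact β : ℝ)) * (F β z.1 - ∑ α ∈ multiIdx n (p - deg β),
          (1 / (mfact α : ℝ)) * F (α + β) z.2 * ∏ i, (z.1 i - z.2 i) ^ α i) := by
    intro β hβ z
    rw [coeff_sub, coeff_fieldPoly, coeff_tr_fieldPoly, if_pos hβ, if_pos hβ, mul_sub]
    rfl
  have key2 : (Sm p A c (fun z => fieldPoly p F z.1 - tr (z.1 - z.2) (fieldPoly p F z.2))) ↔
      ∀ β : Fin n → ℕ, deg β ≤ p → (fun z : (Fin n → ℝ) × (Fin n → ℝ) =>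
        F β z.1 - ∑ α ∈ multiIdx n (p - deg β),
          (1 / (mfact α : ℝ)) * F (α + β) z.2 * ∏ i, (z.1 i - z.2 i) ^ α i) =o[fl A c]
          (fun z => dist z.1 z.2 ^ (p - deg β)) := by
    constructor
    · intro h β hβ
      have := h (toFinsupp β) hβ
      simp only [key β hβ] at this
      exact (isLittleO_const_mul_left_iff (one_div_ne_zero (mfact_ne β))).1 this
    · intro h s hs
      have := h s hs
      rw [← isLittleO_const_mul_left_iff (one_div_ne_zero (mfact_ne s))] at this
      simp only [← key _ hs, toFinsupp_coe] at this
      exact this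
  rw [key2]
  refine forall₂_congr fun β hβ => ?_
  rw [isLittleO_iff]
  refine forall_congr' fun ε => forall_congr' fun hε => ?_
  unfold fl
  rw [Filter.Eventually, Metric.mem_nhdsWithin_iff]
  refine exists_congr fun δ => and_congr_right fun _ => ?_
  constructor
  · rintro h ⟨a, b⟩ ⟨hz, ha, hb⟩
    rw [Metric.mem_ball, Prod.dist_eq, max_lt_iff] at hz
    have := h a ha b hb hz.1 hz.2
    simpa [abs_of_nonneg (pow_nonneg dist_nonneg _)] using this
  · intro h a ha b hb h1 h2
    have := @h (a, b) ⟨by rw [Metric.mem_ball, Prod.dist_eq, max_lt_iff]; exact ⟨h1, h2⟩, ha, hb⟩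
    simpa [abs_of_nonneg (pow_nonneg dist_nonneg _)] using this

/-- degree at most `N` -/
def Dg {n : ℕ} (N : ℕ) (P : MvPolynomial (Fin n) ℝ) : Prop :=
  ∀ s : Fin n →₀ ℕ, N < deg ⇑s → coeff s P = 0

lemma Dg.mul {n j k : ℕ} {P Q : MvPolynomial (Fin n) ℝ} (hP : Dg j P) (hQ : Dg k Q) :
    Dg (j + k) (P * Q) := fun s hs => by
  classical
  rw [coeff_mul]
  refine Finset.sum_eq_zero fun x hx => ?_
  replace hx := Finset.HasAntidiagonal.mem_antidiagonal.1 hx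
  have e : deg ⇑s = deg ⇑x.1 + deg ⇑x.2 := by rw [← deg_add, ← hx]; rfl
  by_cases h : j < deg ⇑x.1
  · rw [hP _ h, zero_mul]
  · rw [hQ _ (by omega), mul_zero]

lemma Dg.mono {n j k : ℕ} {P : MvPolynomial (Fin n) ℝ} (hP : Dg j P) (h : j ≤ k) : Dg k P :=
  fun s hs => hP s (by omega)

lemma Dg.C {n : ℕ} (N : ℕ) (r : ℝ) : Dg N (MvPolynomial.C r : MvPolynomial (Fin n) ℝ) :=
    fun s hs => by
  classical
  rw [coeff_C, if_neg]
  rintro rfl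
  simp [deg] at hs

lemma Dg.sub {n j : ℕ} {P Q : MvPolynomial (Fin n) ℝ} (hP : Dg j P) (hQ : Dg j Q) :
    Dg j (P - Q) := fun s hs => by
  rw [coeff_sub, hP s hs, hQ s hs, sub_zero]

lemma Dg.sum {n j : ℕ} {ι : Type*} (t : Finset ι) {V : ι → MvPolynomial (Fin n) ℝ}
    (hV : ∀ i ∈ t, Dg j (V i)) : Dg j (∑ i ∈ t, V i) := fun s hs => by
  rw [coeff_sum]; exact Finset.sum_eq_zero fun i hi => hV i hi s hs

lemma Dg.pow {n j : ℕ} {P : MvPolynomial (Fin n) ℝ} (hP : Dg j P) (k : ℕ) :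
    Dg (j * k) (P ^ k) := by
  induction k with
  | zero => simpa using Dg.C 0 1
  | succ k ih => rw [pow_succ, mul_add, mul_one]; exact ih.mul hP

lemma Dg.prod {n k : ℕ} {ι : Type*} (t : Finset ι) {V : ι → MvPolynomial (Fin n) ℝ}
    (hV : ∀ j, Dg k (V j)) (γ : ι → ℕ) : Dg (k * ∑ j ∈ t, γ j) (∏ j ∈ t, V j ^ γ j) := by
  classical
  induction t using Finset.induction_on with
  | empty => simpa using Dg.C 0 1
  | insert a t ha ih =>
    rw [Finset.prod_insert ha, Finset.sum_insert ha, mul_add]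
    exact ((hV a).pow _).mul ih

lemma Dg.ofField {n p : ℕ} (F : (Fin n → ℕ) → (Fin n → ℝ) → ℝ) (u : Fin n → ℝ) :
    Dg p (fieldPoly p F u) := fun s hs => by
  rw [← toFinsupp_coe s, coeff_fieldPoly, if_neg (by omega)]

lemma Dg.trField {n p : ℕ} (F : (Fin n → ℕ) → (Fin n → ℝ) → ℝ) (u h : Fin n → ℝ) :
    Dg p (tr h (fieldPoly p F u)) := fun s hs => by
  rw [← toFinsupp_coe s, coeff_tr_fieldPoly, if_neg (by omega)]

lemma Dg.aeval {n m p : ℕ} (F : (Fin n → ℕ) → (Fin n → ℝ) → ℝ) (u : Fin n → ℝ)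
    {V : Fin n → MvPolynomial (Fin m) ℝ} (hV : ∀ j, Dg p (V j)) :
    Dg (p * p) (aeval V (fieldPoly p F u)) := by
  rw [aeval_fieldPoly]
  refine Dg.sum _ fun α hα => ?_
  rw [mem_multiIdx] at hα
  have := (Dg.C 0 (1 / (mfact α : ℝ) * F α u)).mul (Dg.prod Finset.univ hV α)
  refine this.mono ?_
  rw [zero_add]
  exact Nat.mul_le_mul_left _ hα

lemma aeval_expand {n m N : ℕ} {P : MvPolynomial (Fin n) ℝ} (hP : Dg N P)
    (V : Fin n → MvPolynomial (Fin m) ℝ) :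
    aeval V P = ∑ γ ∈ multiIdx n N, C (coeff (toFinsupp γ) P) * ∏ j, V j ^ γ j := by
  have e : P = fieldPoly N (fun α _ => (mfact α : ℝ) * coeff (toFinsupp α) P) 0 := by
    ext s
    rw [← toFinsupp_coe s, coeff_fieldPoly]
    split_ifs with h
    · rw [← mul_assoc, one_div_mul_cancel (mfact_ne _), one_mul]
    · rw [hP]; rw [toFinsupp_coe]; omega
  conv_lhs => rw [e]
  rw [aeval_fieldPoly]
  refine Finset.sum_congr rfl fun α _ => ?_
  rw [← mul_assoc, one_div_mul_cancel (mfact_ne _), one_mul]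

lemma prod_bigO {n : ℕ} (A : Set (Fin n → ℝ)) (c : Fin n → ℝ) (δ : Fin n → ℕ) :
    (fun z : (Fin n → ℝ) × (Fin n → ℝ) => ∏ i, (z.1 i - z.2 i) ^ δ i) =O[fl A c]
      (fun z => dist z.1 z.2 ^ deg δ) := by
  refine IsBigO.of_bound 1 (Eventually.of_forall fun z => ?_)
  rw [one_mul, norm_prod, Real.norm_of_nonneg (pow_nonneg dist_nonneg _)]
  unfold deg
  rw [← Finset.prod_pow_eq_pow_sum]
  refine Finset.prod_le_prod (fun _ _ => norm_nonneg _) fun i _ => ?_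
  rw [norm_pow]
  refine pow_le_pow_left₀ (norm_nonneg _) ?_ _
  rw [← dist_eq_norm]
  exact dist_le_pi_dist _ _ i

lemma continuousOn_fst {n : ℕ} {A : Set (Fin n → ℝ)} {f : (Fin n → ℝ) → ℝ}
    (hf : ContinuousOn f A) : ContinuousOn (fun z : (Fin n → ℝ) × (Fin n → ℝ) => f z.1) (A ×ˢ A) :=
  hf.comp continuous_fst.continuousOn fun _ hz => hz.1

lemma continuousOn_snd {n : ℕ} {A : Set (Fin n → ℝ)} {f : (Fin n → ℝ) → ℝ}
    (hf : ContinuousOn f A) : ContinuousOn (fun z : (Fin n → ℝ) × (Fin n → ℝ) => f z.2) (A ×ˢ A) :=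
  hf.comp continuous_snd.continuousOn fun _ hz => hz.2

/-- translated high order terms are small -/
lemma Sm.tr_high {n p N : ℕ} {A : Set (Fin n → ℝ)} {c : Fin n → ℝ} (hc : c ∈ A)
    {R : (Fin n → ℝ) → MvPolynomial (Fin n) ℝ} (hR : CC A R) (hN : ∀ u, Dg N (R u))
    (hO : ∀ u ∈ A, Ord (p + 1) (R u)) :
    Sm p A c (fun z => tr (z.1 - z.2) (R z.2)) := by
  unfold tr
  simp only [aeval_expand (hN _)]
  refine Sm.sum _ fun γ _ => ?_
  by_cases hγ : deg γ ≤ p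
  · refine Sm.zero.congr fun a _ b hb => ?_
    simp only
    rw [hO b hb (toFinsupp γ) (Nat.lt_succ_of_le hγ), map_zero, zero_mul]
  · intro s hs
    simp only [coeff_C_mul]
    have hb : (fun z : (Fin n → ℝ) × (Fin n → ℝ) => coeff (toFinsupp γ) (R z.2)) =O[fl A c]
        (fun _ => (1 : ℝ)) :=
      (continuousOn_snd (hR (toFinsupp γ)) (c, c) ⟨hc, hc⟩).isBigO_one ℝ
    suffices h : (fun z : (Fin n → ℝ) × (Fin n → ℝ) =>
        coeff s (∏ i, (X i + C ((z.1 - z.2) i) : MvPolynomial (Fin n) ℝ) ^ γ i)) =o[fl A c]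
        (fun z => dist z.1 z.2 ^ (p - deg ⇑s)) by
      simpa using hb.mul_isLittleO h
    rw [← toFinsupp_coe s]
    simp only [coeff_tr_prod]
    simp only [toFinsupp_coe]
    by_cases hle : (⇑s) ≤ γ
    · simp only [Finset.prod_mul_distrib]
      have h1 := (prod_bigO A c (γ - ⇑s)).mul
        (isBigO_refl (fun _ => ∏ i, ((γ i).choose (s i) : ℝ)) (fl A c))
      refine h1.trans_isLittleO ?_
      have e : deg (γ - ⇑s) + deg ⇑s = deg γ := by
        rw [← deg_add]; congr 1; exact tsub_add_cancel_of_le hle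
      have h2 := dist_pow_littleO A c (i := p - deg ⇑s) (j := deg (γ - ⇑s)) (by omega)
      have h3 : (fun _ : (Fin n → ℝ) × (Fin n → ℝ) => ∏ i, ((γ i).choose (s i) : ℝ)) =O[fl A c]
        (fun _ => (1 : ℝ)) := isBigO_const_const _ one_ne_zero _
      simpa using h2.mul_isBigO h3
    · obtain ⟨i, hi⟩ := not_forall.1 hle
      have hi' := not_le.1 hi
      refine (isLittleO_zero _ _).congr_left fun z => ?_
      symm
      apply Finset.prod_eq_zero (Finset.mem_univ i)
      rw [Nat.choose_eq_zero_of_lt hi']; simp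

lemma lipschitz {n p : ℕ} (hp : 1 ≤ p) {A : Set (Fin n → ℝ)} {c : Fin n → ℝ} (hc : c ∈ A)
    {F : (Fin n → ℕ) → (Fin n → ℝ) → ℝ} (hF : IsWhitneyField n p A F) :
    (fun z : (Fin n → ℝ) × (Fin n → ℝ) => F 0 z.1 - F 0 z.2) =O[fl A c]
      (fun z => dist z.1 z.2) := by
  classical
  obtain ⟨hcont, hs⟩ := isWhitney_iff.1 hF
  have hd0 : deg (0 : Fin n → ℕ) = 0 := by simp [deg]
  have hm0 : mfact (0 : Fin n → ℕ) = 1 := by simp [mfact]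
  have h0 := hs c hc (toFinsupp 0) (by show deg (0 : Fin n → ℕ) ≤ p; omega)
  have hexp : (toFinsupp (0 : Fin n → ℕ) : Fin n → ℕ) = 0 := rfl
  have hz : (0 : Fin n → ℕ) ∈ multiIdx n p := by rw [mem_multiIdx]; omega
  simp only [coeff_sub, coeff_fieldPoly, coeff_tr_fieldPoly, hexp, hd0, hm0, zero_le, if_true,
    Nat.sub_zero, add_zero, Nat.cast_one, div_one, one_mul] at h0
  have h1 : (fun z : (Fin n → ℝ) × (Fin n → ℝ) => F 0 z.1 - ∑ α ∈ multiIdx n p,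
      (1 / (mfact α : ℝ)) * F α z.2 * ∏ i, ((z.1 - z.2) i) ^ α i) =O[fl A c]
      (fun z => dist z.1 z.2) := by
    have := h0.isBigO.trans (dist_pow_bigO A c hp)
    simpa using this
  have h2 : (fun z : (Fin n → ℝ) × (Fin n → ℝ) => ∑ α ∈ (multiIdx n p).erase 0,
      (1 / (mfact α : ℝ)) * F α z.2 * ∏ i, ((z.1 - z.2) i) ^ α i) =O[fl A c]
      (fun z => dist z.1 z.2) := by
    refine IsBigO.fun_sum fun α hα => ?_
    rw [Finset.mem_erase, mem_multiIdx] at hα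
    have hpos : 1 ≤ deg α := by
      by_contra hcon
      apply hα.1
      funext i
      have : α i ≤ deg α :=
        Finset.single_le_sum (f := α) (fun _ _ => Nat.zero_le _) (Finset.mem_univ i)
      simp only [Pi.zero_apply]; omega
    have hb : (fun z : (Fin n → ℝ) × (Fin n → ℝ) => (1 / (mfact α : ℝ)) * F α z.2) =O[fl A c]
        (fun _ => (1 : ℝ)) :=
      ((continuousOn_const.mul (continuousOn_snd (hcont α hα.2))) (c, c) ⟨hc, hc⟩).isBigO_one ℝ
    have := hb.mul ((prod_bigO A c α).trans (dist_pow_bigO A c hpos))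
    simpa using this
  refine (h1.add h2).congr_left fun z => ?_
  rw [← Finset.add_sum_erase _ _ hz]
  simp [hm0]
  ring

lemma coeff_truncP {n p : ℕ} (P : MvPolynomial (Fin n) ℝ) (s : Fin n →₀ ℕ) (hs : deg ⇑s ≤ p) :
    coeff s (truncP p P) = coeff s P := by
  classical
  unfold truncP
  rw [coeff_sum]
  simp only [coeff_monomial]
  rw [Finset.sum_ite_eq']
  split_ifs with h
  · rfl
  · by_contra hne
    exact h (Finset.mem_filter.2 ⟨mem_support_iff.2 (Ne.symm hne), hs⟩)

lemma aeval_tr {n m : ℕ} (Y : Fin m → MvPolynomial (Fin n) ℝ) (k : Fin m → ℝ)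
    (P : MvPolynomial (Fin m) ℝ) :
    aeval Y (tr k P) = aeval (fun j => Y j + C (k j)) P := by
  unfold tr
  rw [comp_aeval_apply]
  simp [algHom_C]

lemma tr_aeval {n m : ℕ} (V : Fin m → MvPolynomial (Fin n) ℝ) (h : Fin n → ℝ)
    (P : MvPolynomial (Fin m) ℝ) :
    tr h (aeval V P) = aeval (fun j => tr h (V j)) P := by
  rw [← comp_aeval_apply]

lemma Sm.of_ord {n k p : ℕ} {A : Set (Fin n → ℝ)} {c : Fin n → ℝ}
    {P : (Fin n → ℝ) × (Fin n → ℝ) → MvPolynomial (Fin k) ℝ}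
    (h : ∀ a ∈ A, ∀ b ∈ A, Ord (p + 1) (P (a, b))) : Sm p A c P := fun s hs => by
  refine (isLittleO_zero _ _).congr' ?_ EventuallyEq.rfl
  filter_upwards [self_mem_nhdsWithin] with z hz
  exact (h z.1 hz.1 z.2 hz.2 s (by omega)).symm

/-- the untruncated composition -/
noncomputable def Q {n m : ℕ} (p : ℕ) (F : Fin m → (Fin n → ℕ) → (Fin n → ℝ) → ℝ)
    (H : (Fin m → ℕ) → (Fin m → ℝ) → ℝ) (u : Fin n → ℝ) : MvPolynomial (Fin n) ℝ :=
  aeval (fun j : Fin m => fieldPoly p (F j) u - C (F j 0 u)) (fieldPoly p H (fun j => F j 0 u))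

section main
variable {n m p : ℕ} {A : Set (Fin n → ℝ)} {B : Set (Fin m → ℝ)}
    {F : Fin m → (Fin n → ℕ) → (Fin n → ℝ) → ℝ} {H : (Fin m → ℕ) → (Fin m → ℝ) → ℝ}

lemma deg_zero {n : ℕ} : deg (0 : Fin n → ℕ) = 0 := by simp [deg]

lemma cont_f (hF : ∀ j : Fin m, IsWhitneyField n p A (F j)) :
    ContinuousOn (fun u j => F j 0 u) A :=
  continuousOn_pi.2 fun j => (hF j).1 0 (by rw [deg_zero]; omega)

lemma cont_Hf (hF : ∀ j : Fin m, IsWhitneyField n p A (F j)) (hH : IsWhitneyField m p B H)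
    (hmap : ∀ u ∈ A, (fun j => F j 0 u) ∈ B) (α : Fin m → ℕ) (hα : deg α ≤ p) :
    ContinuousOn (fun u => H α (fun j => F j 0 u)) A :=
  (hH.1 α hα).comp (cont_f hF) hmap

lemma CC_Q (hF : ∀ j : Fin m, IsWhitneyField n p A (F j)) (hH : IsWhitneyField m p B H)
    (hmap : ∀ u ∈ A, (fun j => F j 0 u) ∈ B) : CC A (Q p F H) := by
  unfold Q
  refine CC.aeval (V := fun j u => fieldPoly p (F j) u - C (F j 0 u)) (fun j => ?_)
    (cont_Hf hF hH hmap)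
  exact (CC.fieldPoly (g := fun u => u) (hF j).1).sub
    (CC.C ((hF j).1 0 (by rw [deg_zero]; omega)))

lemma Sm_Hf (hp : 1 ≤ p) (hF : ∀ j : Fin m, IsWhitneyField n p A (F j))
    (hH : IsWhitneyField m p B H) (hmap : ∀ u ∈ A, (fun j => F j 0 u) ∈ B)
    {c : Fin n → ℝ} (hc : c ∈ A) :
    Sm p A c (fun z => fieldPoly p H (fun j => F j 0 z.1) -
      tr ((fun j => F j 0 z.1) - (fun j => F j 0 z.2)) (fieldPoly p H (fun j => F j 0 z.2))) := by
  intro s hs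
  have h := (isWhitney_iff.1 hH).2 _ (hmap c hc) s hs
  have hcont : ContinuousOn (fun z : (Fin n → ℝ) × (Fin n → ℝ) =>
      ((fun j => F j 0 z.1, fun j => F j 0 z.2) : (Fin m → ℝ) × (Fin m → ℝ))) (A ×ˢ A) :=
    ((cont_f hF).comp continuous_fst.continuousOn fun _ hz => hz.1).prodMk
      ((cont_f hF).comp continuous_snd.continuousOn fun _ hz => hz.2)
  have ht : Tendsto (fun z : (Fin n → ℝ) × (Fin n → ℝ) =>
      ((fun j => F j 0 z.1, fun j => F j 0 z.2) : (Fin m → ℝ) × (Fin m → ℝ))) (fl A c)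
      (fl B (fun j => F j 0 c)) :=
    (hcont (c, c) ⟨hc, hc⟩).tendsto_nhdsWithin fun z hz => ⟨hmap _ hz.1, hmap _ hz.2⟩
  have h2 := h.comp_tendsto ht
  refine h2.trans_isBigO ?_
  have hl : (fun z : (Fin n → ℝ) × (Fin n → ℝ) => fun j => F j 0 z.1 - F j 0 z.2) =O[fl A c]
      (fun z => dist z.1 z.2) := isBigO_pi.2 fun j => lipschitz hp hc (hF j)
  have hl2 := hl.norm_left.pow (p - deg ⇑s)
  refine hl2.congr_left fun z => ?_
  simp only [Function.comp, dist_eq_norm]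
  rfl

lemma CC_fst {F : (Fin n → ℕ) → (Fin n → ℝ) → ℝ}
    (hF : ∀ α : Fin n → ℕ, deg α ≤ p → ContinuousOn (F α) A) :
    CC (A ×ˢ A) (fun z : (Fin n → ℝ) × (Fin n → ℝ) => fieldPoly p F z.1) := by
  refine CC.fieldPoly (F := F) (g := fun z : (Fin n → ℝ) × (Fin n → ℝ) => z.1) ?_
  intro α hα
  exact continuousOn_fst (hF α hα)

lemma CC_tr {F : (Fin n → ℕ) → (Fin n → ℝ) → ℝ}
    (hF : ∀ α : Fin n → ℕ, deg α ≤ p → ContinuousOn (F α) A) :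
    CC (A ×ˢ A) (fun z : (Fin n → ℝ) × (Fin n → ℝ) => tr (z.1 - z.2) (fieldPoly p F z.2)) := by
  unfold tr
  refine CC.aeval (V := fun i (z : (Fin n → ℝ) × (Fin n → ℝ)) => X i + C ((z.1 - z.2) i))
    (g := fun z => z.2) (fun i => ?_) fun α hα => continuousOn_snd (hF α hα)
  have h : ContinuousOn (fun z : (Fin n → ℝ) × (Fin n → ℝ) => (z.1 - z.2) i) (A ×ˢ A) := by
    have : Continuous (fun z : (Fin n → ℝ) × (Fin n → ℝ) => z.1 i - z.2 i) :=
      ((continuous_apply i).comp continuous_fst).sub ((continuous_apply i).comp continuous_snd)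
    exact this.continuousOn
  exact (CC.const (X i)).add (CC.C h)

lemma Sm_Q (hp : 1 ≤ p) (hF : ∀ j : Fin m, IsWhitneyField n p A (F j))
    (hH : IsWhitneyField m p B H) (hmap : ∀ u ∈ A, (fun j => F j 0 u) ∈ B)
    {c : Fin n → ℝ} (hc : c ∈ A) :
    Sm p A c (fun z => Q p F H z.1 - tr (z.1 - z.2) (Q p F H z.2)) := by
  have hf0 : ∀ j, ContinuousOn (F j 0) A := fun j => (hF j).1 0 (by rw [deg_zero]; omega)
  have hFa : ∀ j, CC (A ×ˢ A)
      (fun z : (Fin n → ℝ) × (Fin n → ℝ) => fieldPoly p (F j) z.1) := fun j =>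
    CC_fst (hF j).1
  have hY : ∀ j, CC (A ×ˢ A)
      (fun z : (Fin n → ℝ) × (Fin n → ℝ) => fieldPoly p (F j) z.1 - C (F j 0 z.1)) := fun j =>
    (hFa j).sub (CC.C (continuousOn_fst (hf0 j)))
  have hU : ∀ j, CC (A ×ˢ A)
      (fun z : (Fin n → ℝ) × (Fin n → ℝ) => fieldPoly p (F j) z.1 - C (F j 0 z.2)) := fun j =>
    (hFa j).sub (CC.C (continuousOn_snd (hf0 j)))
  have hV : ∀ j, CC (A ×ˢ A) (fun z : (Fin n → ℝ) × (Fin n → ℝ) =>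
      tr (z.1 - z.2) (fieldPoly p (F j) z.2) - C (F j 0 z.2)) := fun j => by
    refine CC.sub ?_ (CC.C (continuousOn_snd (hf0 j)))
    exact CC_tr (hF j).1
  have hUV : ∀ j, Sm p A c (fun z => (fieldPoly p (F j) z.1 - C (F j 0 z.2)) -
      (tr (z.1 - z.2) (fieldPoly p (F j) z.2) - C (F j 0 z.2))) := fun j =>
    ((isWhitney_iff.1 (hF j)).2 c hc).congr fun a _ b _ =>
      (sub_sub_sub_cancel_right _ _ _).symm
  -- change of the inner polynomials
  have hb : Sm p A c (fun z =>
      aeval (fun j => fieldPoly p (F j) z.1 - C (F j 0 z.2)) (fieldPoly p H (fun j => F j 0 z.2)) -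
      aeval (fun j => tr (z.1 - z.2) (fieldPoly p (F j) z.2) - C (F j 0 z.2))
        (fieldPoly p H (fun j => F j 0 z.2))) := by
    simp only [aeval_fieldPoly, ← Finset.sum_sub_distrib, ← mul_sub]
    refine Sm.sum _ fun α hα => ?_
    rw [mem_multiIdx] at hα
    have h1 : Sm p A c (fun z => ∏ j, (fieldPoly p (F j) z.1 - C (F j 0 z.2)) ^ α j -
        ∏ j, (tr (z.1 - z.2) (fieldPoly p (F j) z.2) - C (F j 0 z.2)) ^ α j) :=
      Sm.prod_sub hc Finset.univ (fun j => (hUV j).pow_sub hc (hU j) (hV j) (α j))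
        (fun j => (hU j).pow _) (fun j => (hV j).pow _)
    have h2 : CC (A ×ˢ A) (fun z : (Fin n → ℝ) × (Fin n → ℝ) =>
        (C (1 / (mfact α : ℝ) * H α (fun j => F j 0 z.2)) : MvPolynomial (Fin n) ℝ)) :=
      CC.C (continuousOn_const.mul (continuousOn_snd (cont_Hf hF hH hmap α hα)))
    exact (h1.mul hc h2).congr fun a _ b _ => mul_comm _ _
  -- change of the outer polynomial
  have ha : Sm p A c (fun z =>
      aeval (fun j => fieldPoly p (F j) z.1 - C (F j 0 z.1))
        (fieldPoly p H (fun j => F j 0 z.1) -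
          tr ((fun j => F j 0 z.1) - (fun j => F j 0 z.2))
            (fieldPoly p H (fun j => F j 0 z.2)))) := by
    simp only [aeval_expand ((Dg.ofField _ _).sub (Dg.trField _ _ _))]
    refine Sm.sum _ fun γ hγ => ?_
    rw [mem_multiIdx] at hγ
    intro s hs
    simp only [coeff_C_mul]
    have hord : ∀ z : (Fin n → ℝ) × (Fin n → ℝ), Ord (deg γ)
        (∏ j, (fieldPoly p (F j) z.1 - C (F j 0 z.1)) ^ γ j) := fun z => by
      refine Ord.prod Finset.univ (fun j t ht => ?_) γ
      have h0 : t = toFinsupp 0 := by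
        ext i
        have : t i ≤ deg ⇑t :=
          Finset.single_le_sum (f := ⇑t) (fun _ _ => Nat.zero_le _) (Finset.mem_univ i)
        rw [toFinsupp_apply, Pi.zero_apply]; omega
      rw [h0, coeff_sub, coeff_fieldPoly, if_pos (by rw [deg_zero]; omega)]
      have : toFinsupp (0 : Fin n → ℕ) = 0 := by ext i; rfl
      rw [this, coeff_zero_C]
      simp [mfact]
    by_cases hsγ : deg ⇑s < deg γ
    · refine (isLittleO_zero _ _).congr_left fun z => ?_
      rw [hord z s hsγ, mul_zero]
    · have h1 := Sm_Hf hp hF hH hmap hc (toFinsupp γ) hγ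
      have h2 := (CC.prod Finset.univ fun j _ => (hY j).pow (γ j)).isBigO (c := (c, c)) ⟨hc, hc⟩ s
      have h3 := h1.mul_isBigO h2
      simp only [mul_one] at h3
      refine h3.trans_isBigO (dist_pow_bigO A c ?_)
      have : deg ⇑(toFinsupp γ) = deg γ := rfl
      omega
  refine (ha.add hb).congr fun a _ b _ => ?_
  simp only [Q, map_sub, aeval_tr, tr_aeval]
  have e : ∀ j, (fieldPoly p (F j) a - C (F j 0 a) +
      C (((fun j => F j 0 a) - (fun j => F j 0 b)) j) : MvPolynomial (Fin n) ℝ) =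
      fieldPoly p (F j) a - C (F j 0 b) := fun j => by
    simp
  simp only [e]
  have e2 : ∀ r : ℝ, tr (a - b) (C r) = C r := fun r => by simp [tr, algHom_C]
  simp only [e2]
  ring

end main

end WhitneyAux

open WhitneyAux

/-- **Remark 4.3.** If `F₁, …, F_m` are `C^p`-Whitney fields on a locally closed `A ⊆ ℝⁿ`,
`H` is a `C^p`-Whitney field on a locally closed `B ⊆ ℝ^m`, and `(F₁⁰(u),…,F_m⁰(u)) ∈ B`
for `u ∈ A`, then the composition
`(H ∘ F)(u, X) = π_p[H(F⁰(u); F₁(u,X) - F₁⁰(u), …, F_m(u,X) - F_m⁰(u))]`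
is a `C^p`-Whitney field on `A`. -/
theorem whitneyField_comp (n m p : ℕ) (hp : 1 ≤ p)
    (A : Set (Fin n → ℝ)) (hA : IsLocallyClosed A)
    (B : Set (Fin m → ℝ)) (hB : IsLocallyClosed B)
    (F : Fin m → (Fin n → ℕ) → (Fin n → ℝ) → ℝ)
    (hF : ∀ j : Fin m, IsWhitneyField n p A (F j))
    (H : (Fin m → ℕ) → (Fin m → ℝ) → ℝ) (hH : IsWhitneyField m p B H)
    (hmap : ∀ u ∈ A, (fun j => F j 0 u) ∈ B)
    (G : (Fin n → ℕ) → (Fin n → ℝ) → ℝ)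
    (hG : ∀ σ : Fin n → ℕ, deg σ ≤ p → ∀ u ∈ A,
      G σ u = (mfact σ : ℝ) * MvPolynomial.coeff (toFinsupp σ)
        (truncP p (MvPolynomial.aeval
          (fun j : Fin m => fieldPoly p (F j) u - MvPolynomial.C (F j 0 u))
          (fieldPoly p H (fun j => F j 0 u))))) :
    IsWhitneyField n p A G := by
  have hco : ∀ u ∈ A, ∀ σ : Fin n → ℕ, deg σ ≤ p →
      G σ u = (mfact σ : ℝ) * MvPolynomial.coeff (toFinsupp σ) (Q p F H u) := by
    intro u hu σ hσ
    rw [hG σ hσ u hu, coeff_truncP _ _ hσ]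
    rfl
  have hcont : ∀ σ : Fin n → ℕ, deg σ ≤ p → ContinuousOn (G σ) A := fun σ hσ =>
    (continuousOn_const.mul (CC_Q hF hH hmap (toFinsupp σ))).congr fun u hu => hco u hu σ hσ
  have hord : ∀ u ∈ A, Ord (p + 1) (Q p F H u - fieldPoly p G u) := by
    intro u hu s hs
    have hs' : deg ⇑s ≤ p := by omega
    rw [← toFinsupp_coe s, MvPolynomial.coeff_sub, coeff_fieldPoly, if_pos hs', hco u hu _ hs',
      ← mul_assoc, one_div_mul_cancel (mfact_ne _), one_mul, sub_self]
  refine isWhitney_iff.2 ⟨hcont, fun c hc => ?_⟩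
  have h1 : Sm p A c (fun z => Q p F H z.1 - fieldPoly p G z.1) :=
    Sm.of_ord fun a ha _ _ => hord a ha
  have h2 : Sm p A c (fun z => tr (z.1 - z.2) (Q p F H z.2 - fieldPoly p G z.2)) :=
    Sm.tr_high (N := p * p + p) (R := fun u => Q p F H u - fieldPoly p G u) hc
      ((CC_Q hF hH hmap).sub (CC.fieldPoly (g := fun u => u) hcont))
      (fun u => Dg.sub
        ((Dg.aeval H _ fun j => (Dg.ofField _ _).sub (Dg.C _ _)).mono (by omega))
        ((Dg.ofField G u).mono (by omega))) hord
  refine (((Sm_Q hp hF hH hmap hc).sub h1).add h2).congr fun a _ b _ => ?_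
  simp only [map_sub]
  ring
end
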